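/- arXiv:2004.11100 — 2 statements merged into one kernel-verified Lean document; each statement's English description precedes it below -/
import Mathlib

section
/- Let λ > 0 and let θ_λ ∈ (0, π/2) be the unique angle with tan θ_λ = 1/λ. Let μ_L be a real-valued function defined on an interval I ⊆ (θ_λ − π/2, θ_λ + π/2). Suppose φ ∈ I with φ ∉ {0, π/2}, a ∈ ℝ with a ≠ 1, and a' ∈ ℝ with a' ≠ −1 satisfy the simplified BEM system. Then μ_L(φ) = μ_G(φ), i.e. μ_L(φ) = sin φ · tan(θ_λ − φ). -/
open Real Set

/-- If `(φ, a, a')` solves the simplified BEM system, then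
`μ_L(φ) = μ_G(φ) = sin φ · tan (θ_λ − φ)`. -/
theorem bem_simplified_necessity
    (lam θ : ℝ) (hlam : 0 < lam) (hθ : θ ∈ Ioo 0 (π / 2))
    (htan : Real.tan θ = 1 / lam)
    (I : Set ℝ) (hI : I ⊆ Ioo (θ - π / 2) (θ + π / 2))
    (μL : ℝ → ℝ) (φ a a' : ℝ)
    (hφI : φ ∈ I) (hφ0 : φ ≠ 0) (hφpi : φ ≠ π / 2)
    (ha : a ≠ 1) (ha' : a' ≠ -1)
    (h1 : Real.tan φ = (1 - a) / (lam * (1 + a')))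
    (h2 : a / (1 - a) = μL φ * Real.cos φ / Real.sin φ ^ 2)
    (h3 : a' / (1 - a) = μL φ / (lam * Real.sin φ)) :
    μL φ = Real.sin φ * Real.tan (θ - φ) := by
  obtain ⟨hθ0, hθ1⟩ := hθ
  obtain ⟨hlo, hhi⟩ := hI hφI
  have hsin : Real.sin φ ≠ 0 := by
    rcases lt_or_gt_of_ne hφ0 with h | h
    · exact (Real.sin_neg_of_neg_of_neg_pi_lt h (by linarith)).ne
    · exact (Real.sin_pos_of_pos_of_lt_pi h (by linarith)).ne'
  have hcos : Real.cos φ ≠ 0 := by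
    rcases lt_or_gt_of_ne hφpi with h | h
    · exact (Real.cos_pos_of_mem_Ioo ⟨by linarith, h⟩).ne'
    · exact (Real.cos_neg_of_pi_div_two_lt_of_lt h (by linarith)).ne
  have hcosθ : 0 < Real.cos θ := Real.cos_pos_of_mem_Ioo ⟨by linarith, hθ1⟩
  have hcosd : Real.cos (θ - φ) ≠ 0 :=
    (Real.cos_pos_of_mem_Ioo ⟨by linarith, by linarith⟩).ne'
  have hu : 1 - a ≠ 0 := sub_ne_zero.mpr ha.symm
  have hu' : 1 + a' ≠ 0 := fun h => ha' (by linarith)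
  have hl : lam ≠ 0 := hlam.ne'
  rw [Real.tan_eq_sin_div_cos, div_eq_div_iff hcosθ.ne' hl] at htan
  rw [Real.tan_eq_sin_div_cos, div_eq_div_iff hcos (mul_ne_zero hl hu')] at h1
  rw [div_eq_div_iff hu (pow_ne_zero 2 hsin)] at h2
  rw [div_eq_div_iff hu (mul_ne_zero hl hsin)] at h3
  rw [Real.tan_eq_sin_div_cos, ← mul_div_assoc, eq_div_iff hcosd, Real.sin_sub, Real.cos_sub]
  generalize μL φ = m at *
  have hinflow : lam * Real.sin φ = (1 - a) * (Real.cos φ - m) := by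
    linear_combination h1 - h3
  have hswirl : Real.sin φ ^ 2 = (1 - a) * (Real.sin φ ^ 2 + m * Real.cos φ) := by
    linear_combination h2
  have hbalance : lam * (Real.sin φ ^ 2 + m * Real.cos φ) = Real.sin φ * (Real.cos φ - m) := by
    apply mul_left_cancel₀ (mul_ne_zero hu hsin)
    linear_combination (-lam * Real.sin φ) * hswirl + Real.sin φ ^ 2 * hinflow
  linear_combination Real.sin θ * hbalance -
    (Real.sin φ ^ 2 + m * Real.cos φ) * htan
end

section
/- Let λ > 0 with θ_λ ∈ (0, π/2) defined by tan θ_λ = 1/λ, let m ∈ (0, θ_λ], let μ_D : (0, m] → [0, ∞) be continuous, let (ψ, a_c) be a correction pair, and let τ : (0, m] → [0, 1) be the map sending φ to the unique a ∈ [0, 1) satisfying E(φ, a). If g is strictly decreasing on (0, m], then τ is strictly decreasing on (0, m] (in particular there is at most one φ_c ∈ (0, m] with τ(φ_c) = a_c); if moreover μ_D is continuously differentiable on (0, m) and ψ is continuously differentiable on (0, ∞), then τ is differentiable at every φ ∈ (0, m) with τ(φ) ≠ a_c. -/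
open Real Set

/-- The function `g(φ) = cot φ · tan(θ − φ) + (μ_D(φ)/sin φ)(1 + cot φ · tan(θ − φ))`. -/
noncomputable def gBEM (θ : ℝ) (μD : ℝ → ℝ) (φ : ℝ) : ℝ :=
  (Real.cos φ / Real.sin φ) * Real.tan (θ - φ) +
    (μD φ / Real.sin φ) * (1 + (Real.cos φ / Real.sin φ) * Real.tan (θ - φ))

/-- The implicit equation `E(φ, a)`:
`a/(1−a) + (sin θ · sin φ / cos(θ−φ)) · ψ((a−a_c)_+)/(1−a)² = g(φ)`. -/
def EBEM (θ : ℝ) (μD ψ : ℝ → ℝ) (ac φ a : ℝ) : Prop :=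
  a / (1 - a) +
      (Real.sin θ * Real.sin φ / Real.cos (θ - φ)) * ψ (max (a - ac) 0) / (1 - a) ^ 2
    = gBEM θ μD φ


open Filter Topology

/-- Real-variable implicit function theorem, with the partial derivative given as a number. -/
theorem exists_differentiableAt_implicit {f : ℝ × ℝ → ℝ} {x a d : ℝ}
    (hf : ContDiffAt ℝ 1 f (x, a)) (hd : HasDerivAt (fun b => f (x, b)) d a) (hd0 : d ≠ 0) :
    ∃ s : ℝ → ℝ, DifferentiableAt ℝ s x ∧ s x = a ∧ ∀ᶠ y in 𝓝 x, f (y, s y) = f (x, a) := by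
  have hpartial : HasDerivAt (fun b => f (x, b))
      ((fderiv ℝ f (x, a) ∘L .inr ℝ ℝ ℝ) 1) a :=
    ((hf.differentiableAt one_ne_zero).hasFDerivAt.comp a
      (hasFDerivAt_prodMk_right x a)).hasDerivAt
  have hinv : (fderiv ℝ f (x, a) ∘L .inr ℝ ℝ ℝ).IsInvertible := by
    refine ⟨ContinuousLinearEquiv.unitsEquivAut ℝ (Units.mk0 d hd0), ?_⟩
    ext
    rw [hpartial.unique hd]
    simp
  exact ⟨hf.implicitFunction one_ne_zero hinv,
    (hf.hasStrictFDerivAt_implicitFunction one_ne_zero hinv).differentiableAt,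
    hf.implicitFunction_apply_self one_ne_zero hinv,
    hf.eventually_apply_implicitFunction one_ne_zero hinv⟩

theorem cos_sub_pos_of_mem_Ioc {θ φ : ℝ} (hθ : θ ∈ Ioo 0 (π / 2)) (hφ : φ ∈ Ioc 0 θ) :
    0 < cos (θ - φ) :=
  cos_pos_of_mem_Ioo ⟨by linarith [hφ.2, pi_pos], by linarith [hφ.1, hθ.2]⟩

theorem sin_pos_of_mem_Ioc {θ φ : ℝ} (hθ : θ ∈ Ioo 0 (π / 2)) (hφ : φ ∈ Ioc 0 θ) :
    0 < sin φ :=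
  sin_pos_of_pos_of_lt_pi hφ.1 (by linarith [hφ.2, hθ.2, pi_pos])

theorem bem_coeff_pos {θ φ : ℝ} (hθ : θ ∈ Ioo 0 (π / 2)) (hφ : φ ∈ Ioc 0 θ) :
    0 < sin θ * sin φ / cos (θ - φ) :=
  div_pos (mul_pos (sin_pos_of_mem_Ioc hθ ⟨hθ.1, le_rfl⟩) (sin_pos_of_mem_Ioc hθ hφ))
    (cos_sub_pos_of_mem_Ioc hθ hφ)

theorem monotoneOn_bem_coeff {θ : ℝ} (hθ : θ ∈ Ioo 0 (π / 2)) :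
    MonotoneOn (fun φ => sin θ * sin φ / cos (θ - φ)) (Ioc 0 θ) := by
  intro x hx y hy hxy
  have hs := sin_pos_of_mem_Ioc hθ ⟨hθ.1, le_rfl⟩
  have hc : 0 < cos θ := cos_pos_of_mem_Ioo ⟨by linarith [hθ.1, pi_pos], hθ.2⟩
  have hd : 0 ≤ sin (y - x) := sin_nonneg_of_nonneg_of_le_pi (by linarith)
    (by linarith [hx.1, hy.2, hθ.2, pi_pos])
  have key : sin y * cos (θ - x) - sin x * cos (θ - y) = cos θ * sin (y - x) := by
    rw [cos_sub, cos_sub, sin_sub]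
    ring
  change sin θ * sin x / cos (θ - x) ≤ sin θ * sin y / cos (θ - y)
  rw [div_le_div_iff₀ (cos_sub_pos_of_mem_Ioc hθ hx) (cos_sub_pos_of_mem_Ioc hθ hy)]
  nlinarith [mul_nonneg hs.le (mul_nonneg hc.le hd)]

/-- Monotonicity of the left-hand side of the implicit equation in its coefficient and in `a`. -/
theorem bem_lhs_le {c d a b : ℝ} {h : ℝ → ℝ} (hmono : Monotone h) (hnn : ∀ x, 0 ≤ h x)
    (hc : 0 ≤ c) (hcd : c ≤ d) (hab : a ≤ b) (hb : b < 1) :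
    a / (1 - a) + c * h a / (1 - a) ^ 2 ≤ b / (1 - b) + d * h b / (1 - b) ^ 2 := by
  have h1 : 0 < 1 - b := by linarith
  have h2 : 0 < 1 - a := by linarith
  refine add_le_add ?_ (div_le_div₀ (mul_nonneg (hc.trans hcd) (hnn b))
    (mul_le_mul hcd (hmono hab) (hnn a) (hc.trans hcd)) (by positivity)
    (pow_le_pow_left₀ h1.le (by linarith) 2))
  rw [div_le_div_iff₀ h2 h1]
  linarith

theorem hasDerivAt_bem_lhs {c a h' : ℝ} {h : ℝ → ℝ} (ha : a < 1) (hh : HasDerivAt h h' a) :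
    HasDerivAt (fun b => b / (1 - b) + c * h b / (1 - b) ^ 2)
      (1 / (1 - a) ^ 2 + (c * h' / (1 - a) ^ 2 + 2 * (c * h a) / (1 - a) ^ 3)) a := by
  have h1 : 1 - a ≠ 0 := by linarith
  have hl : HasDerivAt (fun b : ℝ => 1 - b) (-1) a := (hasDerivAt_id a).const_sub 1
  refine (((hasDerivAt_id a).div hl h1).add
    ((hh.const_mul c).div (hl.pow 2) (pow_ne_zero 2 h1))).congr_deriv ?_
  simp only [id, Pi.pow_apply]
  field_simp
  ring

theorem contDiffAt_gBEM {θ φ : ℝ} {μD : ℝ → ℝ} (hθ : θ ∈ Ioo 0 (π / 2)) (hφ : φ ∈ Ioc 0 θ)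
    (hμ : ContDiffAt ℝ 1 μD φ) : ContDiffAt ℝ 1 (gBEM θ μD) φ := by
  have hs := (sin_pos_of_mem_Ioc hθ hφ).ne'
  have htan : ContDiffAt ℝ 1 (fun x => tan (θ - x)) φ :=
    (contDiffAt_tan.2 (cos_sub_pos_of_mem_Ioc hθ hφ).ne').comp φ
      (contDiffAt_const.sub contDiffAt_id)
  have hcot : ContDiffAt ℝ 1 (fun x => cos x / sin x) φ :=
    contDiff_cos.contDiffAt.div contDiff_sin.contDiffAt hs
  exact (hcot.mul htan).add ((hμ.div contDiff_sin.contDiffAt hs).mul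
    (contDiffAt_const.add (hcot.mul htan)))

theorem contDiffAt_comp_max_sub {ψ : ℝ → ℝ} {ac a : ℝ} (hψ : ContDiffOn ℝ 1 ψ (Ioi 0))
    (ha : a ≠ ac) : ContDiffAt ℝ 1 (fun b => ψ (max (b - ac) 0)) a := by
  rcases ha.lt_or_gt with h | h
  · refine (contDiffAt_const (c := ψ 0)).congr_of_eventuallyEq ?_
    filter_upwards [Iio_mem_nhds h] with b hb
    rw [max_eq_right (sub_nonpos.2 (le_of_lt hb))]
  · have hpos : 0 < a - ac := sub_pos.2 h
    have hcomp : ContDiffAt ℝ 1 (fun b => ψ (b - ac)) a :=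
      ContDiffAt.comp a (hψ.contDiffAt (Ioi_mem_nhds hpos)) (contDiffAt_id.sub contDiffAt_const)
    refine hcomp.congr_of_eventuallyEq ?_
    filter_upwards [Ioi_mem_nhds h] with b hb
    rw [max_eq_left (sub_nonneg.2 (le_of_lt hb))]

/-- If `g` is strictly decreasing on `(0, m]`, then the map `τ` is strictly
decreasing there (in particular there is at most one `φ_c` with `τ(φ_c) = a_c`); if moreover
`μ_D` is continuously differentiable on `(0, m)` and `ψ` on `(0, ∞)`, then `τ` is
differentiable at every `φ ∈ (0, m)` with `τ(φ) ≠ a_c`. -/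
theorem bem_tau_strictAnti_differentiable
    (lam θ m : ℝ) (hlam : 0 < lam) (hθ : θ ∈ Ioo 0 (π / 2))
    (htan : Real.tan θ = 1 / lam) (hm : m ∈ Ioc 0 θ)
    (μD : ℝ → ℝ) (hμDc : ContinuousOn μD (Ioc 0 m))
    (hμDnn : ∀ φ ∈ Ioc 0 m, 0 ≤ μD φ)
    (ac : ℝ) (hac : ac ∈ Ioo (0 : ℝ) 1)
    (ψ : ℝ → ℝ) (hψc : ContinuousOn ψ (Ici 0)) (hψmono : MonotoneOn ψ (Ici 0))
    (hψ0 : ψ 0 = 0) (hψnn : ∀ x ∈ Ici (0 : ℝ), 0 ≤ ψ x)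
    (τ : ℝ → ℝ)
    (hτ : ∀ φ ∈ Ioc 0 m, τ φ ∈ Ico (0 : ℝ) 1 ∧ EBEM θ μD ψ ac φ (τ φ))
    (hτuniq : ∀ φ ∈ Ioc 0 m, ∀ a ∈ Ico (0 : ℝ) 1, EBEM θ μD ψ ac φ a → a = τ φ)
    (hg : StrictAntiOn (gBEM θ μD) (Ioc 0 m)) :
    StrictAntiOn τ (Ioc 0 m) ∧
    ((∀ x y, x ∈ Ioc 0 m → y ∈ Ioc 0 m → τ x = ac → τ y = ac → x = y) ∧
     (ContDiffOn ℝ 1 μD (Ioo 0 m) → ContDiffOn ℝ 1 ψ (Ioi 0) →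
      ∀ φ ∈ Ioo 0 m, τ φ ≠ ac → DifferentiableWithinAt ℝ τ (Ioo 0 m) φ)) := by
  set h : ℝ → ℝ := fun a => ψ (max (a - ac) 0) with h_def
  have hmono : Monotone h := fun a b hab =>
    hψmono (mem_Ici.2 (le_max_right _ _)) (mem_Ici.2 (le_max_right _ _)) (max_le_max_right 0 (by linarith))
  have hnn : ∀ a, 0 ≤ h a := fun a => hψnn _ (mem_Ici.2 (le_max_right _ _))
  have hsub : ∀ {φ}, φ ∈ Ioc 0 m → φ ∈ Ioc 0 θ := fun hφ => ⟨hφ.1, hφ.2.trans hm.2⟩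
  have hanti : StrictAntiOn τ (Ioc 0 m) := by
    intro x hx y hy hxy
    by_contra! hle
    refine (hg hx hy hxy).not_ge ?_
    rw [← (hτ x hx).2, ← (hτ y hy).2]
    exact bem_lhs_le hmono hnn (bem_coeff_pos hθ (hsub hx)).le
      (monotoneOn_bem_coeff hθ (hsub hx) (hsub hy) hxy.le) hle (hτ y hy).1.2
  refine ⟨hanti, fun x y hx hy hxa hya => hanti.injOn hx hy (hxa.trans hya.symm), ?_⟩
  intro hμ hψ φ hφ hne
  have hφm : φ ∈ Ioc 0 m := ⟨hφ.1, hφ.2.le⟩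
  have hmm : m ∈ Ioc 0 m := ⟨hm.1, le_rfl⟩
  have hpos : 0 < τ φ := (hτ m hmm).1.1.trans_lt (hanti hφm hmm hφ.2)
  have hlt : τ φ < 1 := (hτ φ hφm).1.2
  have hlt' : 0 < 1 - τ φ := sub_pos.2 hlt
  have hh : ContDiffAt ℝ 1 h (τ φ) := contDiffAt_comp_max_sub hψ hne
  have hc := bem_coeff_pos hθ (hsub hφm)
  let F : ℝ × ℝ → ℝ := fun p => p.2 / (1 - p.2) +
    (sin θ * sin p.1 / cos (θ - p.1)) * h p.2 / (1 - p.2) ^ 2 - gBEM θ μD p.1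
  have hF : ContDiffAt ℝ 1 F (φ, τ φ) := by
    have h2 : ContDiffAt ℝ 1 (fun p : ℝ × ℝ => h p.2) (φ, τ φ) :=
      ContDiffAt.comp (g := h) (φ, τ φ) hh contDiffAt_snd
    have h1 : ContDiffAt ℝ 1 (fun p : ℝ × ℝ => gBEM θ μD p.1) (φ, τ φ) :=
      ContDiffAt.comp (φ, τ φ) (contDiffAt_gBEM hθ (hsub hφm)
        (hμ.contDiffAt (Ioo_mem_nhds hφ.1 hφ.2))) contDiffAt_fst
    have hl : ContDiffAt ℝ 1 (fun p : ℝ × ℝ => 1 - p.2) (φ, τ φ) := by fun_prop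
    have hcoef : ContDiffAt ℝ 1 (fun p : ℝ × ℝ => sin θ * sin p.1 / cos (θ - p.1)) (φ, τ φ) :=
      ContDiffAt.div (by fun_prop) (by fun_prop) (cos_sub_pos_of_mem_Ioc hθ (hsub hφm)).ne'
    exact ((contDiffAt_snd.div hl hlt'.ne').add
      ((hcoef.mul h2).div (hl.pow 2) (pow_ne_zero 2 hlt'.ne'))).sub h1
  have hderiv := (hasDerivAt_bem_lhs (c := sin θ * sin φ / cos (θ - φ)) hlt
    (hh.differentiableAt one_ne_zero).hasDerivAt).sub_const (gBEM θ μD φ)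
  have hh' : 0 ≤ deriv h (τ φ) := hmono.deriv_nonneg
  have hha := hnn (τ φ)
  obtain ⟨s, hs, hsφ, hsE⟩ := exists_differentiableAt_implicit hF hderiv
    (by positivity)
  have hF0 : F (φ, τ φ) = 0 := sub_eq_zero.2 (hτ φ hφm).2
  refine (hs.congr_of_eventuallyEq ?_).differentiableWithinAt
  have hs01 : ∀ᶠ x in 𝓝 φ, s x ∈ Ioo (0 : ℝ) 1 :=
    hs.continuousAt.eventually_mem (by rw [hsφ]; exact Ioo_mem_nhds hpos hlt)
  filter_upwards [hsE, hs01, Ioo_mem_nhds hφ.1 hφ.2] with x hx hx01 hxm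
  exact (hτuniq x ⟨hxm.1, hxm.2.le⟩ (s x) ⟨hx01.1.le, hx01.2⟩
    (sub_eq_zero.1 (hx.trans hF0))).symm
end
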